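/- Fix an instance ([n],{Π_s}) of quantum k-SAT and ε > 0, and let γ be a natural number with γ ≥ 5·4^{k−1}/ε. If ({y₁,…,y_γ}, P₁⊗…⊗P_γ) is a chain of length γ, then every qubit x ∈ [n]∖{y₁,…,y_γ} conflicts with respect to the assignment ({y₁,…,y_γ}, P₁⊗…⊗P_γ), i.e. L_{{y₁,…,y_γ},P₁⊗…⊗P_γ}(x) = 0. -/

import Mathlib

open scoped Classical

namespace QkSAT

/-- The Hilbert space of the qubits indexed by the subset `C` of `[n]`,
with basis indexed by bit strings on `C`. -/
abbrev QVec (n : ℕ) (C : Finset (Fin n)) : Type := (↥C → Fin 2) → ℂ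

/-- Extend an operator acting on the qubits in `s` to an operator on the qubits of `C ⊇ s`
which acts trivially on the qubits outside `s`. -/
noncomputable def extendOp {n : ℕ} (s C : Finset (Fin n))
    (K : Matrix (↥s → Fin 2) (↥s → Fin 2) ℂ) :
    Matrix (↥C → Fin 2) (↥C → Fin 2) ℂ :=
  Matrix.of fun f g =>
    if hs : s ⊆ C then
      if ∀ i : ↥C, (i : Fin n) ∉ s → f i = g i then
        K (fun j => f ⟨j.1, hs j.2⟩) (fun j => g ⟨j.1, hs j.2⟩)
      else 0
    else 0

/-- An instance of quantum `k`-SAT on `n` qubits: for every `k`-element subset `s` of the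
qubits, an orthogonal projection acting nontrivially only on the qubits in `s`, specified by
its matrix on the qubits in `s`. -/
structure Instance (n k : ℕ) where
  K : (s : Finset (Fin n)) → Matrix (↥s → Fin 2) (↥s → Fin 2) ℂ
  isHermitian : ∀ s : Finset (Fin n), s.card = k → (K s).IsHermitian
  isIdempotent : ∀ s : Finset (Fin n), s.card = k → K s * K s = K s

/-- `∑_{s ∈ σ_k(C)} Π_s ψ` for a vector `ψ` on the qubits in `C`. -/
noncomputable def constraintSum {n k : ℕ} (I : Instance n k) (C : Finset (Fin n))
    (ψ : QVec n C) : QVec n C :=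
  ∑ s ∈ Finset.powersetCard k C, (extendOp s C (I.K s)).mulVec ψ

/-- The restriction of the instance to the qubits in `C` is satisfiable. -/
def SatisfiableAt {n k : ℕ} (I : Instance n k) (C : Finset (Fin n)) : Prop :=
  ∃ ψ : QVec n C, ψ ≠ 0 ∧ constraintSum I C ψ = 0

/-- The instance is satisfiable. -/
def Satisfiable {n k : ℕ} (I : Instance n k) : Prop :=
  SatisfiableAt I Finset.univ

/-- The product vector `⊗ᵢ φᵢ`. -/
def prodVec {ι : Type*} [Fintype ι] (φ : ι → (Fin 2 → ℂ)) : (ι → Fin 2) → ℂ :=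
  fun f => ∏ i, φ i (f i)

/-- The instance is locally satisfiable by a product state at `C`. -/
def ProdSatisfiableAt {n k : ℕ} (I : Instance n k) (C : Finset (Fin n)) : Prop :=
  ∃ φ : ↥C → (Fin 2 → ℂ), (∀ i, φ i ≠ 0) ∧ constraintSum I C (prodVec φ) = 0

/-- The instance is `ε`-far from satisfiable by a product state: whenever removing the
constraints indexed by `Sig` admits a (nonzero) product-state solution, `|Sig| ≥ ε n^k`. -/
def EpsFarFromProdSat {n k : ℕ} (I : Instance n k) (ε : ℝ) : Prop :=
  ∀ Sig : Finset (Finset (Fin n)),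
    (∃ φ : ↥(Finset.univ : Finset (Fin n)) → (Fin 2 → ℂ), (∀ i, φ i ≠ 0) ∧
      ∑ s ∈ Finset.powersetCard k (Finset.univ : Finset (Fin n)) \ Sig,
        (extendOp s Finset.univ (I.K s)).mulVec (prodVec φ) = 0) →
    ε * (n : ℝ) ^ k ≤ (Sig.card : ℝ)


variable {n k : ℕ}

/-- The tensor product of a vector on the qubits in `T` with a vector on the qubits in
`S`, as a vector on the qubits in `T ∪ S` (for disjoint `T` and `S`), linear in the
first vector. -/
noncomputable def joinVecL (T S : Finset (Fin n)) (w : QVec n S) :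
    QVec n T →ₗ[ℂ] QVec n (T ∪ S) where
  toFun v := fun f =>
    v (fun i => f ⟨i.1, Finset.mem_union_left S i.2⟩) *
      w (fun i => f ⟨i.1, Finset.mem_union_right T i.2⟩)
  map_add' v v' := by funext f; simp [add_mul]
  map_smul' c v := by funext f; simp [mul_assoc]

/-- The linear map `v ↦ Σ_s Π_s (v ⊗ w)`, the sum over those `s ∈ σ_k(T ⊔ S)` containing
all the qubits of `T`. -/
noncomputable def Lmap (I : Instance n k) (S T : Finset (Fin n)) (w : QVec n S) :
    QVec n T →ₗ[ℂ] QVec n (T ∪ S) :=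
  ∑ s ∈ (Finset.powersetCard k (T ∪ S)).filter (fun s => T ⊆ s),
    (extendOp s (T ∪ S) (I.K s)).mulVecLin ∘ₗ joinVecL T S w

/-- `L_{S,P}(T)`: the space of vectors `v` on the qubits in `T` such that
`Σ_s Π_s (v ⊗ w) = 0` for every `w ∈ P`, the sum over those `s ∈ σ_k(T ⊔ S)` containing
all the qubits of `T`. -/
noncomputable def Lspace (I : Instance n k) (S : Finset (Fin n))
    (P : Submodule ℂ (QVec n S)) (T : Finset (Fin n)) : Submodule ℂ (QVec n T) :=
  ⨅ w ∈ P, LinearMap.ker (Lmap I S T w)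

/-- The product subspace `V_{i₁} ⊗ … ⊗ V_{i_{|S|}} ⊆ H_S` determined by single-qubit
subspaces `V i ⊆ ℂ²`: the span of the product vectors with components in the `V i`. -/
noncomputable def assignSubspace (S : Finset (Fin n))
    (V : Fin n → Submodule ℂ (Fin 2 → ℂ)) : Submodule ℂ (QVec n S) :=
  Submodule.span ℂ {ψ | ∃ φ : ↥S → (Fin 2 → ℂ), (∀ i, φ i ∈ V i.1) ∧ ψ = prodVec φ}

/-- `(S, V)` is an assignment: every state of the product subspace determined by `V` on `S`
satisfies all the projectors on the qubits in `S`. -/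
def IsAssignment (I : Instance n k) (S : Finset (Fin n))
    (V : Fin n → Submodule ℂ (Fin 2 → ℂ)) : Prop :=
  ∀ ψ ∈ assignSubspace S V, constraintSum I S ψ = 0

/-- The canonical identification of `ℂ²` with the Hilbert space of the single qubit `x`. -/
noncomputable def singleLM (n : ℕ) (x : Fin n) :
    (Fin 2 → ℂ) →ₗ[ℂ] QVec n {x} where
  toFun v := fun g => v (g ⟨x, Finset.mem_singleton_self x⟩)
  map_add' _ _ := rfl
  map_smul' _ _ := rfl

/-- `L_{S,P_S}(x)` as a subspace of `ℂ²`, for the assignment `(S, V)`. -/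
noncomputable def Lqubit (I : Instance n k) (S : Finset (Fin n))
    (V : Fin n → Submodule ℂ (Fin 2 → ℂ)) (x : Fin n) : Submodule ℂ (Fin 2 → ℂ) :=
  Submodule.comap (singleLM n x) (Lspace I S (assignSubspace S V) {x})

/-- `δ_{S,P_S,x,V_x,j}`: the total decrease in dimension of the spaces of `j`-qubit
extensions upon extending the assignment `(S, V)` by assigning the subspace `U` to the
qubit `x`. -/
noncomputable def deltaJ (I : Instance n k) (S : Finset (Fin n))
    (V : Fin n → Submodule ℂ (Fin 2 → ℂ)) (x : Fin n)
    (U : Submodule ℂ (Fin 2 → ℂ)) (j : ℕ) : ℤ :=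
  ∑ T ∈ Finset.powersetCard j ((insert x S)ᶜ),
    ((Module.finrank ℂ (Lspace I S (assignSubspace S V) T) : ℤ) -
      (Module.finrank ℂ (Lspace I (insert x S)
        (assignSubspace (insert x S) (Function.update V x U)) T) : ℤ))

/-- `δ_{S,P_S,x,V_x} = Σ_{j=1}^{k−1} δ_{S,P_S,x,V_x,j}·n^{k−j−1}`. -/
noncomputable def delta (I : Instance n k) (S : Finset (Fin n))
    (V : Fin n → Submodule ℂ (Fin 2 → ℂ)) (x : Fin n)
    (U : Submodule ℂ (Fin 2 → ℂ)) : ℤ :=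
  ∑ j ∈ Finset.Icc 1 (k - 1), deltaJ I S V x U j * (n : ℤ) ^ (k - j - 1)

/-- The qubit `x` conflicts with respect to the assignment `(S, V)`. -/
def Conflicts (I : Instance n k) (S : Finset (Fin n))
    (V : Fin n → Submodule ℂ (Fin 2 → ℂ)) (x : Fin n) : Prop :=
  Lqubit I S V x = ⊥

/-- The qubit `x` is heavy with respect to the assignment `(S, V)`: it does not conflict,
and every (nonzero) extension to `x` decreases the dimension of the space of possible
extensions by more than `ε n^{k−1}/5`. -/
def Heavy (I : Instance n k) (ε : ℝ) (S : Finset (Fin n))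
    (V : Fin n → Submodule ℂ (Fin 2 → ℂ)) (x : Fin n) : Prop :=
  Lqubit I S V x ≠ ⊥ ∧
    ∀ U : Submodule ℂ (Fin 2 → ℂ), U ≤ Lqubit I S V x → U ≠ ⊥ →
      ε * (n : ℝ) ^ (k - 1) / 5 < (delta I S V x U : ℝ)

/-- The qubit `x` is bad with respect to the assignment `(S, V)`: heavy or conflicting. -/
def Bad (I : Instance n k) (ε : ℝ) (S : Finset (Fin n))
    (V : Fin n → Submodule ℂ (Fin 2 → ℂ)) (x : Fin n) : Prop :=
  Conflicts I S V x ∨ Heavy I ε S V x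

/-- The set `{y₁, …, y_l}` of the first `l` qubits of the sequence `y`. -/
def chainSet {m : ℕ} (y : Fin m → Fin n) (l : ℕ) : Finset (Fin n) :=
  (Finset.univ.filter (fun i : Fin m => (i : ℕ) < l)).image y

/-- `(y, V)` is a chain of length `m`: the qubits `y₁, …, y_m` are distinct, each prefix
`({y₁,…,y_l}, P₁⊗…⊗P_l)` is an assignment, and each `y_l` is heavy with respect to the
assignment `({y₁,…,y_{l−1}}, P₁⊗…⊗P_{l−1})` (for `l = 1`, with respect to the empty
assignment). -/
def IsChain (I : Instance n k) (ε : ℝ) (m : ℕ) (y : Fin m → Fin n)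
    (V : Fin n → Submodule ℂ (Fin 2 → ℂ)) : Prop :=
  Function.Injective y ∧
    (∀ l : ℕ, l ≤ m → IsAssignment I (chainSet y l) V) ∧
    ∀ l : Fin m, Heavy I ε (chainSet y (l : ℕ)) V (y l)

end QkSAT

namespace QkSAT

section

variable {n k : ℕ}

section Positivity

open scoped ComplexOrder

/-- Extending an operator is tensoring it with the identity. -/
lemma extendOp_eq_submatrix_kronecker {s C : Finset (Fin n)} (hs : s ⊆ C)
    (K : Matrix (↥s → Fin 2) (↥s → Fin 2) ℂ) :
    extendOp s C K =
      (Matrix.kroneckerMap (· * ·) K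
        (1 : Matrix ({i : ↥C // i.1 ∉ s} → Fin 2) ({i : ↥C // i.1 ∉ s} → Fin 2) ℂ)).submatrix
        (fun f => (fun j : ↥s => f ⟨j.1, hs j.2⟩, fun j => f j.1))
        (fun f => (fun j : ↥s => f ⟨j.1, hs j.2⟩, fun j => f j.1)) := by
  ext f g
  simp [extendOp, hs, Matrix.one_apply, funext_iff]

lemma extendOp_posSemidef {s C : Finset (Fin n)} (hs : s ⊆ C)
    {K : Matrix (↥s → Fin 2) (↥s → Fin 2) ℂ} (hK : K.PosSemidef) :
    (extendOp s C K).PosSemidef := by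
  rw [extendOp_eq_submatrix_kronecker hs]
  exact (hK.kronecker Matrix.PosSemidef.one).submatrix _

lemma Instance.posSemidef (I : Instance n k) {s : Finset (Fin n)} (hs : s.card = k) :
    (I.K s).PosSemidef := by
  have h := Matrix.posSemidef_conjTranspose_mul_self (I.K s)
  rwa [(I.isHermitian s hs).eq, I.isIdempotent s hs] at h

/-- A vector killed by the sum of the constraints is killed by each constraint. -/
lemma extendOp_mulVec_eq_zero_of_constraintSum (I : Instance n k) {C : Finset (Fin n)}
    {ψ : QVec n C} (hψ : constraintSum I C ψ = 0) {s : Finset (Fin n)}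
    (hs : s ∈ Finset.powersetCard k C) : (extendOp s C (I.K s)).mulVec ψ = 0 := by
  have hpos : ∀ t ∈ Finset.powersetCard k C, (extendOp t C (I.K t)).PosSemidef := fun t ht =>
    extendOp_posSemidef (Finset.mem_powersetCard.1 ht).1
      (I.posSemidef (Finset.mem_powersetCard.1 ht).2)
  have hsum : ∑ t ∈ Finset.powersetCard k C,
      dotProduct (star ψ) ((extendOp t C (I.K t)).mulVec ψ) = 0 := by
    rw [← dotProduct_sum]
    change dotProduct (star ψ) (constraintSum I C ψ) = 0
    simp [hψ]
  exact ((hpos s hs).dotProduct_mulVec_zero_iff ψ).1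
    ((Finset.sum_eq_zero_iff_of_nonneg
      fun t ht => (hpos t ht).dotProduct_mulVec_nonneg ψ).1 hsum s hs)

end Positivity

lemma joinVecL_mem_assignSubspace {S : Finset (Fin n)} {V : Fin n → Submodule ℂ (Fin 2 → ℂ)}
    {x : Fin n} (hx : x ∉ S) {v : Fin 2 → ℂ} (hv : v ∈ V x) {w : QVec n S}
    (hw : w ∈ assignSubspace S V) :
    joinVecL {x} S w (singleLM n x v) ∈ assignSubspace ({x} ∪ S) V := by
  induction hw using Submodule.span_induction with
  | mem w hw =>
    obtain ⟨φ, hφ, rfl⟩ := hw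
    refine Submodule.subset_span
      ⟨fun i => if h : i.1 ∈ S then φ ⟨i.1, h⟩ else v, fun i => ?_, ?_⟩
    · by_cases h : i.1 ∈ S
      · simpa [h] using hφ ⟨i.1, h⟩
      · have hi : i.1 = x := by
          simpa [h] using i.2
        simp only [dif_neg h]
        rwa [hi]
    · funext f
      have key : ∀ F : Fin n → ℂ, ∏ i : ↥({x} ∪ S), F i.1 = F x * ∏ i : ↥S, F i.1 := by
        intro F
        rw [Finset.prod_coe_sort ({x} ∪ S) F, Finset.prod_coe_sort S F, ← Finset.insert_eq,
          Finset.prod_insert hx]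
      let F : Fin n → ℂ := fun i =>
        if h : i ∈ {x} ∪ S then
          (if h' : i ∈ S then φ ⟨i, h'⟩ else v) (f ⟨i, h⟩) else 1
      have h := key F
      have hl : ∀ i : ↥({x} ∪ S),
          (if h' : i.1 ∈ S then φ ⟨i.1, h'⟩ else v) (f i) = F i.1 := by
        intro i
        simp only [F, dif_pos i.2]
      have hr : ∀ i : ↥S, φ i (f ⟨i.1, Finset.mem_union_right _ i.2⟩) = F i.1 := by
        intro i
        simp only [F, dif_pos i.2, dif_pos (Finset.mem_union_right {x} i.2)]
      have h0 : v (f ⟨x, Finset.mem_union_left _ (Finset.mem_singleton_self x)⟩) = F x := by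
        simp [F, hx]
      simp only [joinVecL, singleLM, prodVec, LinearMap.coe_mk, AddHom.coe_mk]
      rw [Finset.prod_congr rfl fun i _ => hl i, Finset.prod_congr rfl fun i _ => hr i, h0, h]
  | zero =>
    convert Submodule.zero_mem _ using 1
    funext f
    exact mul_zero _
  | add w₁ w₂ _ _ h₁ h₂ =>
    convert Submodule.add_mem _ h₁ h₂ using 1
    funext f
    exact mul_add _ _ _
  | smul c w _ h =>
    convert Submodule.smul_mem _ c h using 1
    funext f
    exact mul_left_comm _ _ _

/-- If `V` is an assignment to `S ⊔ {x}`, then `V x` lies in `L_{S,V}(x)`. -/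
lemma IsAssignment.le_Lqubit {I : Instance n k} {S : Finset (Fin n)}
    {V : Fin n → Submodule ℂ (Fin 2 → ℂ)} {x : Fin n} (hx : x ∉ S)
    (h : IsAssignment I (insert x S) V) : V x ≤ Lqubit I S V x := by
  rw [Finset.insert_eq] at h
  intro v hv
  simp only [Lqubit, Lspace, Submodule.mem_comap, Submodule.mem_iInf, LinearMap.mem_ker]
  intro w hw
  simp only [Lmap, LinearMap.sum_apply, LinearMap.comp_apply, Matrix.mulVecLin_apply]
  exact Finset.sum_eq_zero fun s hs => extendOp_mulVec_eq_zero_of_constraintSum I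
    (h _ (joinVecL_mem_assignSubspace hx hv hw)) (Finset.mem_filter.1 hs).1

lemma assignSubspace_eq_bot {S : Finset (Fin n)} {V : Fin n → Submodule ℂ (Fin 2 → ℂ)}
    {z : Fin n} (hz : z ∈ S) (hV : V z = ⊥) : assignSubspace S V = ⊥ := by
  rw [assignSubspace, Submodule.span_eq_bot]
  rintro _ ⟨φ, hφ, rfl⟩
  have h0 : φ ⟨z, hz⟩ = 0 := by simpa [hV] using hφ ⟨z, hz⟩
  funext f
  exact Finset.prod_eq_zero (Finset.mem_univ ⟨z, hz⟩) (by simp [h0])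

lemma Lspace_bot (I : Instance n k) (S T : Finset (Fin n)) : Lspace I S ⊥ T = ⊤ := by
  have h : Lmap I S T 0 = 0 := by
    ext v f
    have hj : joinVecL T S 0 = 0 := by
      ext v f
      simp [joinVecL]
    simp [Lmap, hj]
  simp [Lspace, h]

lemma delta_eq_zero_of_eq_bot (I : Instance n k) {S : Finset (Fin n)}
    {V : Fin n → Submodule ℂ (Fin 2 → ℂ)} {x z : Fin n} (hx : x ∉ S) (hz : z ∈ S)
    (hV : V z = ⊥) (U : Submodule ℂ (Fin 2 → ℂ)) : delta I S V x U = 0 := by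
  have hzx : z ≠ x := fun h => hx (h ▸ hz)
  have h₁ (T : Finset (Fin n)) : Lspace I S (assignSubspace S V) T = ⊤ := by
    rw [assignSubspace_eq_bot hz hV, Lspace_bot]
  have h₂ (T : Finset (Fin n)) :
      Lspace I (insert x S) (assignSubspace (insert x S) (Function.update V x U)) T = ⊤ := by
    rw [assignSubspace_eq_bot (Finset.mem_insert_of_mem hz) (by simp [hzx, hV]), Lspace_bot]
  refine Finset.sum_eq_zero fun j _ => ?_
  rw [deltaJ, Finset.sum_eq_zero fun T _ => by rw [h₁, h₂, sub_self], zero_mul]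

lemma Heavy.ne_bot {I : Instance n k} {ε : ℝ} (hε : 0 ≤ ε) {S : Finset (Fin n)}
    {V : Fin n → Submodule ℂ (Fin 2 → ℂ)} {x z : Fin n} (h : Heavy I ε S V x)
    (hx : x ∉ S) (hz : z ∈ S) : V z ≠ ⊥ := by
  intro hV
  have h' := h.2 _ le_rfl h.1
  rw [delta_eq_zero_of_eq_bot I hx hz hV, Int.cast_zero] at h'
  exact absurd h' (not_lt.2 (by positivity))

/-- The weighted total dimension of the spaces of extensions of the assignment `(S, V)`. -/
noncomputable def extensionWeight (I : Instance n k) (S : Finset (Fin n))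
    (V : Fin n → Submodule ℂ (Fin 2 → ℂ)) : ℤ :=
  ∑ j ∈ Finset.Icc 1 (k - 1), (∑ T ∈ Finset.powersetCard j Sᶜ,
    (Module.finrank ℂ (Lspace I S (assignSubspace S V) T) : ℤ)) * (n : ℤ) ^ (k - j - 1)

lemma extensionWeight_nonneg (I : Instance n k) (S : Finset (Fin n))
    (V : Fin n → Submodule ℂ (Fin 2 → ℂ)) : 0 ≤ extensionWeight I S V := by
  unfold extensionWeight
  positivity

lemma delta_add_extensionWeight_le (I : Instance n k) (S : Finset (Fin n))
    (V : Fin n → Submodule ℂ (Fin 2 → ℂ)) (x : Fin n) (U : Submodule ℂ (Fin 2 → ℂ)) :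
    delta I S V x U + extensionWeight I (insert x S) (Function.update V x U) ≤
      extensionWeight I S V := by
  unfold delta extensionWeight
  rw [← Finset.sum_add_distrib]
  refine Finset.sum_le_sum fun j _ => ?_
  rw [← add_mul]
  refine mul_le_mul_of_nonneg_right ?_ (by positivity)
  rw [deltaJ, Finset.sum_sub_distrib, sub_add_cancel]
  refine Finset.sum_le_sum_of_subset_of_nonneg (Finset.powersetCard_mono ?_)
    fun _ _ _ => by positivity
  exact Finset.compl_subset_compl.2 (Finset.subset_insert x S)

lemma sum_Icc_two_pow_le_four_pow (m : ℕ) : ∑ j ∈ Finset.Icc 1 m, 2 ^ j ≤ 4 ^ m := by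
  induction m with
  | zero => simp
  | succ m ih =>
    rw [Finset.sum_Icc_succ_top (by omega), pow_succ, pow_succ]
    have : 2 ^ m ≤ 4 ^ m := Nat.pow_le_pow_left (by norm_num) m
    omega

lemma extensionWeight_le (I : Instance n k) (S : Finset (Fin n))
    (V : Fin n → Submodule ℂ (Fin 2 → ℂ)) :
    extensionWeight I S V ≤ 4 ^ (k - 1) * (n : ℤ) ^ (k - 1) := by
  have hterm : ∀ j ∈ Finset.Icc 1 (k - 1), (∑ T ∈ Finset.powersetCard j Sᶜ,
      (Module.finrank ℂ (Lspace I S (assignSubspace S V) T) : ℤ)) * (n : ℤ) ^ (k - j - 1) ≤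
      2 ^ j * (n : ℤ) ^ (k - 1) := by
    intro j hj
    rw [Finset.mem_Icc] at hj
    have hdim : ∀ T ∈ Finset.powersetCard j Sᶜ,
        (Module.finrank ℂ (Lspace I S (assignSubspace S V) T) : ℤ) ≤ 2 ^ j := by
      intro T hT
      have := (Lspace I S (assignSubspace S V) T).finrank_le
      simp only [Module.finrank_fintype_fun_eq_card, Fintype.card_pi, Fintype.card_fin,
        Finset.prod_const, Finset.card_univ, Fintype.card_coe,
        (Finset.mem_powersetCard.1 hT).2] at this
      exact_mod_cast this
    have hcard : ((Finset.powersetCard j Sᶜ).card : ℤ) ≤ (n : ℤ) ^ j := by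
      rw [Finset.card_powersetCard]
      exact_mod_cast (Nat.choose_le_pow _ _).trans
        (Nat.pow_le_pow_left (by simpa using Finset.card_le_univ Sᶜ) j)
    have hpow : (n : ℤ) ^ (k - 1) = (n : ℤ) ^ j * (n : ℤ) ^ (k - j - 1) := by
      rw [← pow_add]
      congr 1
      omega
    calc _ ≤ ((n : ℤ) ^ j * 2 ^ j) * (n : ℤ) ^ (k - j - 1) := by
          refine mul_le_mul_of_nonneg_right ?_ (by positivity)
          refine (Finset.sum_le_card_nsmul _ _ _ hdim).trans ?_
          rw [nsmul_eq_mul]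
          exact mul_le_mul_of_nonneg_right hcard (by positivity)
      _ = _ := by rw [hpow]; ring
  refine (Finset.sum_le_sum hterm).trans ?_
  rw [← Finset.sum_mul]
  refine mul_le_mul_of_nonneg_right ?_ (by positivity)
  exact_mod_cast sum_Icc_two_pow_le_four_pow (k - 1)

lemma chainSet_zero {m : ℕ} (y : Fin m → Fin n) : chainSet y 0 = ∅ := by
  simp [chainSet]

lemma mem_chainSet {m : ℕ} {y : Fin m → Fin n} (hy : Function.Injective y) {i : Fin m} {l : ℕ} :
    y i ∈ chainSet y l ↔ (i : ℕ) < l := by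
  simp [chainSet, hy.eq_iff]

lemma chainSet_succ {m : ℕ} (y : Fin m → Fin n) (i : Fin m) :
    chainSet y (i + 1) = insert (y i) (chainSet y i) := by
  rw [chainSet, chainSet, ← Finset.image_insert]
  congr 1
  ext j
  simp only [Finset.mem_filter, Finset.mem_univ, true_and, Finset.mem_insert, Fin.ext_iff]
  omega

/-- Every step of a chain before the last one lowers the extension weight by more than
`ε n^{k-1}/5`. -/
lemma IsChain.extensionWeight_add_le {I : Instance n k} {ε : ℝ} (hε : 0 ≤ ε) {m : ℕ}
    {y : Fin m → Fin n} {V : Fin n → Submodule ℂ (Fin 2 → ℂ)} (h : IsChain I ε m y V)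
    {l : ℕ} (hl : l < m) :
    l * (ε * (n : ℝ) ^ (k - 1) / 5) + extensionWeight I (chainSet y l) V ≤
      extensionWeight I ∅ V := by
  obtain ⟨hy, hassign, hheavy⟩ := h
  induction l with
  | zero => simp [chainSet_zero]
  | succ l ih =>
    have hlm : l < m := by omega
    let i : Fin m := ⟨l, hlm⟩
    have hi : y i ∉ chainSet y l := by simp [mem_chainSet hy, i]
    have hsucc : chainSet y (l + 1) = insert (y i) (chainSet y l) := chainSet_succ y i
    have hle : V (y i) ≤ Lqubit I (chainSet y l) V (y i) :=
      IsAssignment.le_Lqubit hi (hsucc ▸ hassign (l + 1) hl.le)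
    have hne : V (y i) ≠ ⊥ := by
      refine (hheavy ⟨l + 1, hl⟩).ne_bot hε ?_ ?_ <;> simp [mem_chainSet hy, i]
    have hlt := (hheavy i).2 _ hle hne
    have hstep := delta_add_extensionWeight_le I (chainSet y l) V (y i) (V (y i))
    rw [Function.update_eq_self, ← hsucc] at hstep
    have hstep' : (delta I (chainSet y l) V (y i) (V (y i)) : ℝ) +
        extensionWeight I (chainSet y (l + 1)) V ≤ extensionWeight I (chainSet y l) V := by
      exact_mod_cast hstep
    have := ih hlm
    push_cast
    change _ < (delta I (chainSet y l) V (y i) (V (y i)) : ℝ) at hlt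
    linarith

/-- Chains are shorter than `5·4^{k−1}/ε`. -/
lemma IsChain.length_lt {I : Instance n k} {ε : ℝ} (hε : 0 < ε) {m : ℕ}
    {y : Fin m → Fin n} {V : Fin n → Submodule ℂ (Fin 2 → ℂ)} (h : IsChain I ε m y V) :
    (m : ℝ) < 5 * 4 ^ (k - 1) / ε := by
  rcases m with _ | l
  · simp only [Nat.cast_zero]
    positivity
  have hl := h.extensionWeight_add_le hε.le (Nat.lt_succ_self l)
  let i : Fin (l + 1) := Fin.last l
  have hheavy : Heavy I ε (chainSet y l) V (y i) := h.2.2 i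
  have hlt := hheavy.2 _ le_rfl hheavy.1
  have hstep := (le_add_of_nonneg_right (extensionWeight_nonneg I _ _)).trans
    (delta_add_extensionWeight_le I (chainSet y l) V (y i) (Lqubit I (chainSet y l) V (y i)))
  have hstep' : (delta I (chainSet y l) V (y i) (Lqubit I (chainSet y l) V (y i)) : ℝ) ≤
      extensionWeight I (chainSet y l) V := by exact_mod_cast hstep
  have hbound : (extensionWeight I ∅ V : ℝ) ≤ 4 ^ (k - 1) * (n : ℝ) ^ (k - 1) := by
    exact_mod_cast extensionWeight_le I ∅ V
  have hn : (0 : ℝ) < (n : ℝ) ^ (k - 1) := by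
    have : 0 < n := (y i).pos
    positivity
  rw [lt_div_iff₀ hε]
  refine lt_of_mul_lt_mul_right ?_ hn.le
  push_cast
  linarith

end

/-- **Lemma (chains cannot be extended past `5·4^{k−1}/ε` heavy qubits).**
If `(y, V)` is a chain of length `γ ≥ 5·4^{k−1}/ε`, then every qubit
`x ∉ {y₁,…,y_γ}` conflicts with respect to the chain. -/
theorem chain_forces_conflict (n k : ℕ) (I : Instance n k) (ε : ℝ) (hε : 0 < ε)
    (γ : ℕ) (hγ : 5 * (4 : ℝ) ^ (k - 1) / ε ≤ (γ : ℝ))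
    (y : Fin γ → Fin n) (V : Fin n → Submodule ℂ (Fin 2 → ℂ))
    (hchain : IsChain I ε γ y V) :
    ∀ x : Fin n, x ∉ chainSet y γ → Conflicts I (chainSet y γ) V x := by
  exact absurd hγ (not_le.2 (hchain.length_lt hε))

end QkSAT
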